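/- Let n ≥ p be positive integers, let ℒ : ℝ^{n×p} → ℝ be differentiable with Euclidean gradient ∇ℒ, let η, γ, α, k₁, k₂ > 0, and let W = {(θ,φ) ∈ ℝ^{n×p}×ℝ^{n×p} : ‖θᵀθ − I‖ < 1}. Let V(θ,φ) = (k₁/4)‖θᵀθ − I‖² + (k₂/2)‖Sym(θᵀφ)‖² with gradient ∇V(θ,φ) = (k₁θ(θᵀθ − I) + k₂φ·Sym(θᵀφ), k₂θ·Sym(θᵀφ)). Define D = −γφ − ∇ℒ(θ), X_θ = φ − θ(θᵀθ)^{-1}Sym(θᵀφ), X_φ = θ(θᵀθ)^{-1}((θᵀθ)^{-1}θᵀφ·Sym(θᵀφ) − φᵀφ) + (D − θ(θᵀθ)^{-1}Sym(θᵀD))/η, and the modified vector field Y(θ,φ) = (X_θ − (α/4)θ(I − (θᵀθ)^{-1}), X_φ − (α/4)θ(θᵀθ)^{-1}(φᵀθ(θᵀθ)^{-1} + θᵀφ)). Then ⟨∇V(θ,φ), Y(θ,φ)⟩ = −α·V(θ,φ) for all (θ,φ) ∈ W, where ⟨(A₁,A₂),(B₁,B₂)⟩ = ⟨A₁,B₁⟩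 + ⟨A₂,B₂⟩. -/

import Mathlib

open Matrix Set Filter

attribute [local instance] Matrix.normedAddCommGroup Matrix.normedSpace

noncomputable section

/-- `Sym(A) = (A + Aᵀ)/2`. -/
def symPart {p : ℕ} (A : Matrix (Fin p) (Fin p) ℝ) : Matrix (Fin p) (Fin p) ℝ :=
  (1 / 2 : ℝ) • (A + Aᵀ)

/-- Euclidean (Frobenius) inner product `⟨A, B⟩ = tr(AᵀB)`. -/
def mInner {m k : ℕ} (A B : Matrix (Fin m) (Fin k) ℝ) : ℝ := (Aᵀ * B).trace

/-- The norm induced from `mInner`. -/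
def mNorm {m k : ℕ} (A : Matrix (Fin m) (Fin k) ℝ) : ℝ := Real.sqrt (mInner A A)

/-- `V(θ,φ) = (k₁/4)‖θᵀθ - I‖² + (k₂/2)‖Sym(θᵀφ)‖²`. -/
def Vfun {n p : ℕ} (k₁ k₂ : ℝ)
    (q : Matrix (Fin n) (Fin p) ℝ × Matrix (Fin n) (Fin p) ℝ) : ℝ :=
  k₁ / 4 * mNorm (q.1ᵀ * q.1 - 1) ^ 2 + k₂ / 2 * mNorm (symPart (q.1ᵀ * q.2)) ^ 2

/-- `∇V(θ,φ) = (k₁θ(θᵀθ - I) + k₂φ·Sym(θᵀφ), k₂θ·Sym(θᵀφ))`. -/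
def gradV {n p : ℕ} (k₁ k₂ : ℝ)
    (q : Matrix (Fin n) (Fin p) ℝ × Matrix (Fin n) (Fin p) ℝ) :
    Matrix (Fin n) (Fin p) ℝ × Matrix (Fin n) (Fin p) ℝ :=
  (k₁ • (q.1 * (q.1ᵀ * q.1 - 1)) + k₂ • (q.2 * symPart (q.1ᵀ * q.2)),
    k₂ • (q.1 * symPart (q.1ᵀ * q.2)))

/-- The extended vector field `X = (X_θ, X_φ)` of system (7) on the ambient space. -/
def extVF {n p : ℕ} (η γ : ℝ)
    (G : Matrix (Fin n) (Fin p) ℝ → Matrix (Fin n) (Fin p) ℝ)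
    (q : Matrix (Fin n) (Fin p) ℝ × Matrix (Fin n) (Fin p) ℝ) :
    Matrix (Fin n) (Fin p) ℝ × Matrix (Fin n) (Fin p) ℝ :=
  (q.2 - q.1 * (q.1ᵀ * q.1)⁻¹ * symPart (q.1ᵀ * q.2),
    q.1 * (q.1ᵀ * q.1)⁻¹ *
        ((q.1ᵀ * q.1)⁻¹ * (q.1ᵀ * q.2) * symPart (q.1ᵀ * q.2) - q.2ᵀ * q.2) +
      η⁻¹ • ((-(γ • q.2) - G q.1) -
        q.1 * (q.1ᵀ * q.1)⁻¹ * symPart (q.1ᵀ * (-(γ • q.2) - G q.1))))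

/-- The modified (feedback) vector field `Y` of system (7). -/
def fbVF {n p : ℕ} (η γ α : ℝ)
    (G : Matrix (Fin n) (Fin p) ℝ → Matrix (Fin n) (Fin p) ℝ)
    (q : Matrix (Fin n) (Fin p) ℝ × Matrix (Fin n) (Fin p) ℝ) :
    Matrix (Fin n) (Fin p) ℝ × Matrix (Fin n) (Fin p) ℝ :=
  ((extVF η γ G q).1 - (α / 4) • (q.1 * (1 - (q.1ᵀ * q.1)⁻¹)),
    (extVF η γ G q).2 -
      (α / 4) • (q.1 * (q.1ᵀ * q.1)⁻¹ * (q.2ᵀ * q.1 * (q.1ᵀ * q.1)⁻¹ + q.1ᵀ * q.2)))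

theorem mInner_self_nonneg' {m k : ℕ} (A : Matrix (Fin m) (Fin k) ℝ) :
    mInner A A = ∑ i, ∑ j, A i j ^ 2 := by
  unfold mInner
  simp only [Matrix.trace, Matrix.diag, Matrix.mul_apply, Matrix.transpose_apply]
  rw [Finset.sum_comm]
  simp only [sq]

theorem mNorm_sq {m k : ℕ} (A : Matrix (Fin m) (Fin k) ℝ) : mNorm A ^ 2 = mInner A A := by
  unfold mNorm
  apply Real.sq_sqrt
  rw [mInner_self_nonneg']
  positivity

theorem isUnit_det_of_near {p : ℕ} (P : Matrix (Fin p) (Fin p) ℝ) (h : mNorm (P - 1) < 1) :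
    IsUnit P.det := by
  rw [isUnit_iff_ne_zero]
  intro hdet
  obtain ⟨v, hv, hPv⟩ := Matrix.exists_mulVec_eq_zero_iff.mpr hdet
  have h1 : (P - 1) *ᵥ v = -v := by
    rw [Matrix.sub_mulVec, hPv, Matrix.one_mulVec, zero_sub]
  have hlt : mInner (P - 1) (P - 1) < 1 := by
    rw [← mNorm_sq]
    have h0 : 0 ≤ mNorm (P - 1) := Real.sqrt_nonneg _
    nlinarith
  rw [mInner_self_nonneg'] at hlt
  have hle : ∑ i, v i ^ 2 ≤ (∑ i, ∑ j, (P - 1) i j ^ 2) * ∑ j, v j ^ 2 := by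
    rw [Finset.sum_mul]
    apply Finset.sum_le_sum
    intro i _
    have h2 : v i ^ 2 = (∑ j, (P - 1) i j * v j) ^ 2 := by
      have h3 := congrFun h1 i
      simp only [Matrix.mulVec, dotProduct, Pi.neg_apply] at h3
      rw [h3, neg_sq]
    rw [h2]
    exact Finset.sum_mul_sq_le_sq_mul_sq _ _ _
  have hpos : 0 < ∑ i, v i ^ 2 := by
    obtain ⟨i, hi⟩ := Function.ne_iff.mp hv
    apply Finset.sum_pos' (fun i _ => sq_nonneg _)
    exact ⟨i, Finset.mem_univ _, by have : v i ≠ 0 := hi; positivity⟩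
  nlinarith

theorem symPart_transpose {p : ℕ} (A : Matrix (Fin p) (Fin p) ℝ) :
    (symPart A)ᵀ = symPart A := by
  unfold symPart
  rw [Matrix.transpose_smul, Matrix.transpose_add, Matrix.transpose_transpose, add_comm]

theorem trace_mul_transpose_of_symm {p : ℕ} (S A : Matrix (Fin p) (Fin p) ℝ) (hS : Sᵀ = S) :
    (S * Aᵀ).trace = (S * A).trace := by
  rw [← Matrix.trace_transpose, Matrix.transpose_mul, Matrix.transpose_transpose, hS,
    Matrix.trace_mul_comm]

theorem trace_mul_symPart {p : ℕ} (S A : Matrix (Fin p) (Fin p) ℝ) (hS : Sᵀ = S) :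
    (S * symPart A).trace = (S * A).trace := by
  unfold symPart
  rw [Matrix.mul_smul, Matrix.trace_smul, Matrix.mul_add, Matrix.trace_add,
    trace_mul_transpose_of_symm S A hS, smul_eq_mul]
  ring

/-- `⟨∇V(θ,φ), Y(θ,φ)⟩ = -α·V(θ,φ)` for all `(θ,φ) ∈ W`. -/
theorem stmt9 (n p : ℕ) (hp : 0 < p) (hpn : p ≤ n)
    (L : Matrix (Fin n) (Fin p) ℝ → ℝ)
    (G : Matrix (Fin n) (Fin p) ℝ → Matrix (Fin n) (Fin p) ℝ)
    (L' : Matrix (Fin n) (Fin p) ℝ → (Matrix (Fin n) (Fin p) ℝ →L[ℝ] ℝ))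
    (hLdiff : ∀ X, HasFDerivAt L (L' X) X)
    (hLgrad : ∀ X H, L' X H = mInner (G X) H)
    (η γ α k₁ k₂ : ℝ) (hη : 0 < η) (hγ : 0 < γ) (hα : 0 < α)
    (hk₁ : 0 < k₁) (hk₂ : 0 < k₂)
    (θ φ : Matrix (Fin n) (Fin p) ℝ)
    (hW : mNorm (θᵀ * θ - 1) < 1) :
    mInner (gradV k₁ k₂ (θ, φ)).1 (fbVF η γ α G (θ, φ)).1 +
      mInner (gradV k₁ k₂ (θ, φ)).2 (fbVF η γ α G (θ, φ)).2 =
      -(α * Vfun k₁ k₂ (θ, φ)) := by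
  have hP := isUnit_det_of_near _ hW
  have hPs : (θᵀ * θ)ᵀ = θᵀ * θ := by simp
  have hM : φᵀ * θ = (θᵀ * φ)ᵀ := by simp
  unfold Vfun
  rw [mNorm_sq, mNorm_sq]
  simp only [gradV, fbVF, extVF]
  generalize hD : -(γ • φ) - G θ = D
  have hS := symPart_transpose (θᵀ * φ)
  have hSM := trace_mul_symPart (symPart (θᵀ * φ)) (θᵀ * φ) hS
  have hSE := trace_mul_symPart (symPart (θᵀ * φ)) (θᵀ * D) hS
  have hNs : (θᵀ * θ - 1)ᵀ = θᵀ * θ - 1 := by simp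
  have hNM := trace_mul_symPart (θᵀ * θ - 1) (θᵀ * φ) hNs
  have hSMt := trace_mul_transpose_of_symm (symPart (θᵀ * φ)) (θᵀ * φ) hS
  have hPQ := Matrix.mul_nonsing_inv _ hP
  have hQs : ((θᵀ * θ)⁻¹)ᵀ = (θᵀ * θ)⁻¹ := by rw [Matrix.transpose_nonsing_inv, hPs]
  generalize symPart (θᵀ * φ) = S at *
  generalize symPart (θᵀ * D) = F at *
  generalize (θᵀ * θ)⁻¹ = Q at *
  have hc (A : Matrix (Fin p) (Fin p) ℝ) : θᵀ * (θ * (Q * A)) = A := by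
    rw [← Matrix.mul_assoc, ← Matrix.mul_assoc, hPQ, Matrix.one_mul]
  have hSQ : (S * (φᵀ * (θ * (Q * S)))).trace = (S * (Q * (θᵀ * (φ * S)))).trace := by
    rw [← Matrix.trace_transpose]
    simp only [Matrix.transpose_mul, Matrix.transpose_transpose, hS, hQs, Matrix.mul_assoc]
  have e1 : mInner (k₁ • (θ * (θᵀ * θ - 1)) + k₂ • (φ * S))
        (φ - θ * Q * S - (α / 4) • (θ * (1 - Q)))
      = k₁ * (((θᵀ * θ - 1) * (θᵀ * φ)).trace - ((θᵀ * θ - 1) * S).trace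
          - α / 4 * ((θᵀ * θ - 1) * (θᵀ * θ - 1)).trace)
        + k₂ * ((S * (φᵀ * φ)).trace - (S * (φᵀ * (θ * (Q * S)))).trace
          - α / 4 * ((S * (φᵀ * θ)).trace - (S * (φᵀ * (θ * Q))).trace)) := by
    have a1 : θᵀ * (φ - θ * Q * S - (α / 4) • (θ * (1 - Q)))
        = θᵀ * φ - S - (α / 4) • (θᵀ * θ - 1) := by
      simp only [Matrix.mul_sub, Matrix.mul_smul, Matrix.mul_assoc, hc, Matrix.mul_one]
      rw [← Matrix.mul_assoc θᵀ θ Q, hPQ]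
    unfold mInner
    rw [Matrix.transpose_add, Matrix.transpose_smul, Matrix.transpose_smul,
      Matrix.transpose_mul, Matrix.transpose_mul, hNs, hS, Matrix.add_mul, Matrix.smul_mul,
      Matrix.smul_mul, Matrix.mul_assoc, a1]
    generalize θᵀ * θ - 1 = N
    simp only [Matrix.mul_sub, Matrix.mul_smul, Matrix.mul_assoc, Matrix.mul_one,
      Matrix.trace_add, Matrix.trace_sub, Matrix.trace_smul, smul_eq_mul]
  have e2 : mInner (k₂ • (θ * S))
        (θ * Q * (Q * (θᵀ * φ) * S - φᵀ * φ) + η⁻¹ • (D - θ * Q * F)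
          - (α / 4) • (θ * Q * (φᵀ * θ * Q + θᵀ * φ)))
      = k₂ * ((S * (Q * (θᵀ * (φ * S)))).trace - (S * (φᵀ * φ)).trace
          + η⁻¹ * ((S * (θᵀ * D)).trace - (S * F).trace)
          - α / 4 * ((S * (φᵀ * (θ * Q))).trace + (S * (θᵀ * φ)).trace)) := by
    unfold mInner
    rw [Matrix.transpose_smul, Matrix.transpose_mul, hS, Matrix.smul_mul, Matrix.mul_assoc]
    simp only [Matrix.mul_sub, Matrix.mul_add, Matrix.mul_smul, Matrix.mul_assoc, hc,
      Matrix.trace_add, Matrix.trace_sub, Matrix.trace_smul, smul_eq_mul]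
  rw [e1, e2, hSQ, hM, hSMt, hSE, hNM]
  unfold mInner
  rw [hNs, hS, hSM]
  ring
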